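/- Fix κ ∈ (0,1), q ∈ [0,1], w > 0, and a finite Borel measure μ on [0,1] having a continuous, everywhere positive density with respect to Lebesgue measure. If (f*,a*) is a pure-strategy Nash equilibrium, then d₁* = ∫₀¹ f₁* dμ > 0 and d₂* = ∫₀¹ f₂* dμ > 0. -/

import Mathlib

open MeasureTheory Set

noncomputable section

/-- `μ` is a finite Borel measure on `[0,1]` with a continuous, everywhere positive
density with respect to Lebesgue measure. -/
def NiceDensity (μ : Measure ℝ) : Prop :=
  ∃ g : ℝ → ℝ, ContinuousOn g (Icc 0 1) ∧ (∀ p ∈ Icc (0:ℝ) 1, 0 < g p) ∧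
    μ = (volume.restrict (Icc (0:ℝ) 1)).withDensity (fun p => ENNReal.ofReal (g p))

/-- Total amount wagered by the diffuse players on Outcome 1. -/
def d1 (μ : Measure ℝ) (f : ℝ → ℝ × ℝ) : ℝ := ∫ p in Icc (0:ℝ) 1, (f p).1 ∂μ

/-- Total amount wagered by the diffuse players on Outcome 2. -/
def d2 (μ : Measure ℝ) (f : ℝ → ℝ × ℝ) : ℝ := ∫ p in Icc (0:ℝ) 1, (f p).2 ∂μ

/-- The implied probability of Outcome 1, `P^{f,a}`. -/
def impliedProb (μ : Measure ℝ) (f : ℝ → ℝ × ℝ) (a : ℝ × ℝ) : ℝ :=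
  (d1 μ f + a.1) / (d1 μ f + d2 μ f + a.1 + a.2)

/-- A feasible strategy profile for the diffuse players. -/
def FeasibleDiffuse (f : ℝ → ℝ × ℝ) : Prop :=
  Measurable f ∧ ∀ p ∈ Icc (0:ℝ) 1, 0 ≤ (f p).1 ∧ 0 ≤ (f p).2 ∧ (f p).1 + (f p).2 ≤ 1

/-- A feasible strategy profile for the atomic player. -/
def FeasibleAtomic (w : ℝ) (a : ℝ × ℝ) : Prop := 0 ≤ a.1 ∧ 0 ≤ a.2 ∧ a.1 + a.2 ≤ w

/-- The expected profit of a bettor who believes Outcome 1 occurs with probability `p`,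
betting `b1` on Outcome 1 and `b2` on Outcome 2, when the implied probability of
Outcome 1 is `P` (with the indicator conventions of the paper). -/
def payoff (κ P p b1 b2 : ℝ) : ℝ :=
  b1 * ((if P = 0 then 0 else κ * p / P) - 1) +
  b2 * ((if P = 1 then 0 else κ * (1 - p) / (1 - P)) - 1)

/-- A pure-strategy Nash equilibrium. -/
def IsEquilibrium (κ q w : ℝ) (μ : Measure ℝ) (f : ℝ → ℝ × ℝ) (a : ℝ × ℝ) : Prop :=
  FeasibleDiffuse f ∧ FeasibleAtomic w a ∧
  0 < d1 μ f + d2 μ f + a.1 + a.2 ∧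
  (∀ p ∈ Icc (0:ℝ) 1,
    payoff κ (impliedProb μ f a) p (f p).1 (f p).2 =
      sSup {x | ∃ b1 b2 : ℝ, 0 ≤ b1 ∧ 0 ≤ b2 ∧ b1 + b2 ≤ 1 ∧
        x = payoff κ (impliedProb μ f a) p b1 b2}) ∧
  payoff κ (impliedProb μ f a) q a.1 a.2 =
    sSup {x | ∃ b1 b2 : ℝ, 0 ≤ b1 ∧ 0 ≤ b2 ∧ b1 + b2 ≤ w ∧
      0 < d1 μ f + d2 μ f + b1 + b2 ∧
      x = payoff κ (impliedProb μ f (b1, b2)) q b1 b2}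

lemma payoff_symm (κ P p b1 b2 : ℝ) : payoff κ (1 - P) (1 - p) b2 b1 = payoff κ P p b1 b2 := by
  unfold payoff
  have h0 : (1 - P = 0) ↔ P = 1 := by constructor <;> intro h <;> linarith
  have h1 : (1 - P = 1) ↔ P = 0 := by constructor <;> intro h <;> linarith
  simp only [h0, h1, sub_sub_cancel]
  ring

/-- If nobody but the atomic player bets on Outcome 1, lowering a positive bet is profitable. -/
lemma atomic_core (κ q w D a1 a2 : ℝ) (hκ : κ ∈ Ioo (0:ℝ) 1) (hq : q ∈ Icc (0:ℝ) 1)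
    (hD : 0 ≤ D) (ha1 : 0 < a1) (ha2 : 0 ≤ a2) (haw : a1 + a2 ≤ w)
    (H : ∀ b1 b2 : ℝ, 0 ≤ b1 → 0 ≤ b2 → b1 + b2 ≤ w → 0 < D + b1 + b2 →
      payoff κ (b1 / (D + b1 + b2)) q b1 b2 ≤ payoff κ (a1 / (D + a1 + a2)) q a1 a2) :
    False := by
  obtain ⟨hκ0, hκ1⟩ := hκ
  obtain ⟨hq0, hq1⟩ := hq
  have hH := H (a1 / 2) a2 (by linarith) ha2 (by linarith) (by linarith)
  have hκq : κ * q < 1 := by nlinarith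
  rcases (add_nonneg hD ha2).eq_or_lt with h0 | h0
  · have hD0 : D = 0 := by linarith
    have ha0 : a2 = 0 := by linarith
    subst hD0 ha0
    have e1 : a1 / 2 / (0 + a1 / 2 + 0) = 1 := by field_simp; ring
    have e2 : a1 / (0 + a1 + 0) = 1 := by field_simp; ring
    rw [e1, e2] at hH
    simp [payoff] at hH
    nlinarith
  · have form : ∀ b, 0 < b → payoff κ (b / (D + b + a2)) q b a2 =
        κ * q * (D + b + a2) - b + a2 * (κ * (1 - q) * (D + b + a2) / (D + a2) - 1) := by
      intro b hb
      have hT : 0 < D + b + a2 := by linarith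
      have n0 : b / (D + b + a2) ≠ 0 := by positivity
      have e : 1 - b / (D + b + a2) = (D + a2) / (D + b + a2) := by field_simp; ring
      have n1 : b / (D + b + a2) ≠ 1 := by
        intro h
        rw [h] at e
        have : 0 < (D + a2) / (D + b + a2) := by positivity
        linarith
      unfold payoff
      rw [if_neg n0, if_neg n1, e]
      field_simp
    rw [form _ ha1, form _ (by linarith : 0 < a1 / 2)] at hH
    have hr : a2 / (D + a2) ≤ 1 := by rw [div_le_one h0]; linarith
    have e1 : ∀ b, a2 * (κ * (1 - q) * (D + b + a2) / (D + a2) - 1) =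
        κ * (1 - q) * (D + b + a2) * (a2 / (D + a2)) - a2 := by
      intro b; ring
    rw [e1, e1] at hH
    have hc : 0 ≤ κ * (1 - q) := mul_nonneg hκ0.le (by linarith)
    have h3 : κ * (1 - q) * (a2 / (D + a2)) ≤ κ * (1 - q) := mul_le_of_le_one_right hc hr
    have h4 : 0 < a1 * (1 - κ * q - κ * (1 - q) * (a2 / (D + a2))) := by
      apply mul_pos ha1
      linarith
    nlinarith

lemma term_bound (κ p P b T : ℝ) (hκ : κ ∈ Ioo (0:ℝ) 1) (hp : p ∈ Icc (0:ℝ) 1) (hT : 0 ≤ T)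
    (hP : 0 ≤ P) (hb : 0 ≤ b) (hbP : b ≤ P * T) :
    b * ((if P = 0 then 0 else κ * p / P) - 1) ≤ T := by
  obtain ⟨hκ0, hκ1⟩ := hκ
  obtain ⟨hp0, hp1⟩ := hp
  split_ifs with h
  · nlinarith
  · have hP' : 0 < P := lt_of_le_of_ne hP (Ne.symm h)
    have h1 : b / P ≤ T := by rw [div_le_iff₀ hP']; linarith
    have h2 : κ * p ≤ 1 := by nlinarith
    have h3 : 0 ≤ b / P := by positivity
    have e : b * (κ * p / P - 1) = κ * p * (b / P) - b := by ring
    rw [e]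
    nlinarith

lemma payoff_bound (κ q D1 D2 b1 b2 : ℝ) (hκ : κ ∈ Ioo (0:ℝ) 1) (hq : q ∈ Icc (0:ℝ) 1)
    (h1 : 0 ≤ D1) (h2 : 0 ≤ D2) (hb1 : 0 ≤ b1) (hb2 : 0 ≤ b2) (hT : 0 < D1 + D2 + b1 + b2) :
    payoff κ ((D1 + b1) / (D1 + D2 + b1 + b2)) q b1 b2 ≤ 2 * (D1 + D2 + b1 + b2) := by
  have t1 := term_bound κ q ((D1 + b1) / (D1 + D2 + b1 + b2)) b1 _ hκ hq hT.le (by positivity) hb1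
    (by rw [div_mul_cancel₀ _ hT.ne']; linarith)
  have e : 1 - (D1 + b1) / (D1 + D2 + b1 + b2) = (D2 + b2) / (D1 + D2 + b1 + b2) := by
    field_simp; ring
  have t2 := term_bound κ (1 - q) (1 - (D1 + b1) / (D1 + D2 + b1 + b2)) b2 _ hκ
    ⟨by linarith [hq.2], by linarith [hq.1]⟩ hT.le (by rw [e]; positivity) hb2
    (by rw [e, div_mul_cancel₀ _ hT.ne']; linarith)
  have h0 : (1 - (D1 + b1) / (D1 + D2 + b1 + b2) = 0) ↔
      (D1 + b1) / (D1 + D2 + b1 + b2) = 1 := by constructor <;> intro h <;> linarith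
  simp only [h0] at t2
  unfold payoff
  linarith

/-- If all implied probability sits on one outcome, no diffuse player bets. -/
lemma diffuse_zero (κ P p c1 c2 : ℝ) (hκ : κ ∈ Ioo (0:ℝ) 1) (hp : p ∈ Icc (0:ℝ) 1)
    (hP : P = 0) (h1 : 0 ≤ c1) (h2 : 0 ≤ c2)
    (h : 0 ≤ payoff κ P p c1 c2) : c1 = 0 ∧ c2 = 0 := by
  subst hP
  obtain ⟨hκ0, hκ1⟩ := hκ
  obtain ⟨hp0, hp1⟩ := hp
  simp [payoff] at h
  have hk : κ * (1 - p) < 1 := by nlinarith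
  have hc : c2 = 0 := by
    by_contra hne
    have : 0 < c2 := lt_of_le_of_ne h2 (Ne.symm hne)
    nlinarith
  subst hc
  constructor <;> linarith

/-- Step 1 of the main theorem: in equilibrium the diffuse players wager positive
amounts on both outcomes. -/
theorem stmt_7 (κ q w : ℝ) (hκ : κ ∈ Ioo (0:ℝ) 1) (hq : q ∈ Icc (0:ℝ) 1) (hw : 0 < w)
    (μ : Measure ℝ) (hμ : NiceDensity μ)
    (f : ℝ → ℝ × ℝ) (a : ℝ × ℝ) (h : IsEquilibrium κ q w μ f a) :
    0 < d1 μ f ∧ 0 < d2 μ f := by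
  obtain ⟨⟨-, hf⟩, ⟨ha1, ha2, haw⟩, hT, hdiff, hatom⟩ := h
  have hd1 : 0 ≤ d1 μ f := setIntegral_nonneg measurableSet_Icc fun p hp => (hf p hp).1
  have hd2 : 0 ≤ d2 μ f := setIntegral_nonneg measurableSet_Icc fun p hp => (hf p hp).2.1
  have hnn : ∀ p ∈ Icc (0:ℝ) 1, 0 ≤ payoff κ (impliedProb μ f a) p (f p).1 (f p).2 := by
    intro p hp
    rw [hdiff p hp]
    by_cases hb : BddAbove {x | ∃ b1 b2 : ℝ, 0 ≤ b1 ∧ 0 ≤ b2 ∧ b1 + b2 ≤ 1 ∧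
        x = payoff κ (impliedProb μ f a) p b1 b2}
    · exact le_csSup hb ⟨0, 0, le_rfl, le_rfl, by norm_num, by simp [payoff]⟩
    · rw [Real.sSup_of_not_bddAbove hb]
  have H : ∀ b1 b2 : ℝ, 0 ≤ b1 → 0 ≤ b2 → b1 + b2 ≤ w → 0 < d1 μ f + d2 μ f + b1 + b2 →
      payoff κ (impliedProb μ f (b1, b2)) q b1 b2 ≤ payoff κ (impliedProb μ f a) q a.1 a.2 := by
    intro b1 b2 h1 h2 h3 h4
    rw [hatom]
    refine le_csSup ⟨2 * (d1 μ f + d2 μ f + w), ?_⟩ ⟨b1, b2, h1, h2, h3, h4, rfl⟩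
    rintro x ⟨c1, c2, k1, k2, k3, k4, rfl⟩
    have := payoff_bound κ q _ _ c1 c2 hκ hq hd1 hd2 k1 k2 k4
    unfold impliedProb
    simp only
    linarith
  have C1 : d1 μ f = 0 → 0 < a.1 → False := by
    intro h0 hpos
    refine atomic_core κ q w (d2 μ f) a.1 a.2 hκ hq hd2 hpos ha2 haw ?_
    intro b1 b2 h1 h2 h3 h4
    have := H b1 b2 h1 h2 h3 (by rw [h0]; linarith)
    simpa only [impliedProb, h0, zero_add] using this
  have C2 : d2 μ f = 0 → 0 < a.2 → False := by
    intro h0 hpos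
    refine atomic_core κ (1 - q) w (d1 μ f) a.2 a.1 hκ ⟨by linarith [hq.2], by linarith [hq.1]⟩
      hd1 hpos ha1 (by linarith) ?_
    have e : ∀ b1 b2 : ℝ, 0 < d1 μ f + b2 + b1 →
        payoff κ (b2 / (d1 μ f + b2 + b1)) (1 - q) b2 b1 =
          payoff κ (impliedProb μ f (b1, b2)) q b1 b2 := by
      intro b1 b2 hb
      rw [← payoff_symm κ (impliedProb μ f (b1, b2))]
      congr 1
      have hb' : d1 μ f + 0 + b1 + b2 ≠ 0 := by linarith
      simp only [impliedProb, h0]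
      field_simp
      ring
    intro b2 b1 h2 h1 h3 h4
    rw [e _ _ h4, e _ _ (by linarith)]
    exact H b1 b2 h1 h2 (by linarith) (by rw [h0]; linarith)
  constructor
  · refine lt_of_le_of_ne hd1 fun h0 => ?_
    have h0 := h0.symm
    rcases ha1.eq_or_lt with h | h
    · have hP : impliedProb μ f a = 0 := by simp [impliedProb, h0, ← h]
      have hz : d2 μ f = 0 := setIntegral_eq_zero_of_forall_eq_zero fun p hp =>
        (diffuse_zero κ _ p _ _ hκ hp hP (hf p hp).1 (hf p hp).2.1 (hnn p hp)).2
      exact C2 hz (by linarith)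
    · exact C1 h0 h
  · refine lt_of_le_of_ne hd2 fun h0 => ?_
    have h0 := h0.symm
    rcases ha2.eq_or_lt with h | h
    · have hP : 1 - impliedProb μ f a = 0 := by
        have hb' : d1 μ f + 0 + a.1 + 0 ≠ 0 := by linarith
        simp only [impliedProb, h0, ← h]
        field_simp
        ring
      have hz : d1 μ f = 0 := setIntegral_eq_zero_of_forall_eq_zero fun p hp =>
        (diffuse_zero κ _ (1 - p) _ _ hκ ⟨by linarith [hp.2], by linarith [hp.1]⟩ hP
          (hf p hp).2.1 (hf p hp).1 (by rw [payoff_symm]; exact hnn p hp)).2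
      exact C1 hz (by linarith)
    · exact C2 h0 h
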